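/- Let α be an expansive partition of exponent θ ≥ 0 that is eventually decreasing. Then lim_{N→∞} dim_H(G_N^(α)) = 1/(1+θ), where G_N^(α) = {x = [ℓ_1(x), ℓ_2(x), ...]_α ∈ (0,1] : ℓ_i(x) > N for all i ∈ ℕ}. -/

import Mathlib

open Filter Set MeasureTheory Topology

noncomputable section

/-- Data of a countable interval partition `α` of `(0,1]`: `a n` is the Lebesgue
measure of the `n`-th atom `A_n` (for `n ≥ 1`), the atoms are ordered from right
to left and their measures sum to `1`. -/
structure LurothData where
  a : ℕ → ℝ
  pos : ∀ n, 1 ≤ n → 0 < a n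
  summ : Summable fun n => a (n + 1)
  total : (∑' n : ℕ, a (n + 1)) = 1

namespace LurothData

variable (P : LurothData)

/-- the `n`-th tail `t_n = Σ_{k ≥ n} a_k`. -/
def t (n : ℕ) : ℝ := ∑' k : ℕ, P.a (n + k)

/-- the index `n` of the atom `A_n = (t_{n+1}, t_n]` containing `x` (and `0` if none). -/
def digit (x : ℝ) : ℕ := sInf {n | 1 ≤ n ∧ x ∈ Set.Ioc (P.t (n + 1)) (P.t n)}

/-- the α-Lüroth map `L_α`. -/
def map (x : ℝ) : ℝ :=
  if P.digit x = 0 then 0 else (P.t (P.digit x) - x) / P.a (P.digit x)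

/-- `dseq P n x` is the `(n+1)`-st α-Lüroth digit `ℓ_{n+1}(x)`. -/
def dseq (n : ℕ) (x : ℝ) : ℕ := P.digit (P.map^[n] x)

/-- the finite α-Lüroth expansion `[ℓ_1, …, ℓ_k]_α`. -/
def val : List ℕ → ℝ
  | [] => 0
  | l :: ls => P.t l - P.a l * val ls

/-- the α-Lüroth cylinder set `C_α(ℓ_1, …, ℓ_k)` (as the set of points whose
first `k` digits are prescribed). -/
def cyl (ls : List ℕ) : Set ℝ :=
  {x | x ∈ Set.Ioc (0 : ℝ) 1 ∧ ∀ i : Fin ls.length, P.dseq i x = ls.get i}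

end LurothData

/-- A (discretely sampled) slowly varying function. -/
def SlowlyVaryingN (ψ : ℕ → ℝ) : Prop :=
  ∀ c : ℕ, 0 < c → Tendsto (fun n => ψ (c * n) / ψ n) atTop (𝓝 1)

/-- `α` is expansive of exponent `θ`: `t_n = ψ(n) n^{-θ}` with `ψ` slowly varying. -/
def LurothData.Expansive (P : LurothData) (θ : ℝ) : Prop :=
  ∃ ψ : ℕ → ℝ, (∀ n, 0 < ψ n) ∧ SlowlyVaryingN ψ ∧
    ∀ n, 1 ≤ n → P.t n = ψ n * (n : ℝ) ^ (-θ)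

/-- `α` is eventually decreasing. -/
def LurothData.EventuallyDecreasing (P : LurothData) : Prop :=
  ∃ N : ℕ, ∀ n, N ≤ n → P.a (n + 1) < P.a n

/-- the α-Good set `G_N^{(α)}`. -/
def LurothData.goodSet (P : LurothData) (N : ℕ) : Set ℝ :=
  {x | x ∈ Set.Ioc (0 : ℝ) 1 ∧ ∀ n : ℕ, N < P.dseq n x}

/-- `G_∞^{(α)}`: points whose digits tend to infinity. -/
def LurothData.Ginf (P : LurothData) : Set ℝ :=
  {x | x ∈ Set.Ioc (0 : ℝ) 1 ∧ Tendsto (fun n => P.dseq n x) atTop atTop}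

/-- `F_∞^{(α)}`: points whose digits are non-decreasing and tend to infinity. -/
def LurothData.Finf (P : LurothData) : Set ℝ :=
  {x | x ∈ P.Ginf ∧ ∀ n : ℕ, P.dseq n x ≤ P.dseq (n + 1) x}

end

namespace LurothData

variable (P : LurothData)

lemma summable_add (n : ℕ) : Summable fun k => P.a (n + k) := by
  have h : Summable P.a := (summable_nat_add_iff 1).1 P.summ
  simpa only [add_comm n] using (summable_nat_add_iff n).2 h

lemma t_eq (n : ℕ) : P.t n = P.a n + P.t (n + 1) := by
  have h := (P.summable_add n).tsum_eq_zero_add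
  simp only [t, add_zero] at h ⊢
  rw [h]
  congr 2
  ext k
  congr 1
  ring

lemma t_one : P.t 1 = 1 := by
  rw [← P.total]
  simp only [t, add_comm 1]

lemma t_pos {n : ℕ} (hn : 1 ≤ n) : 0 < P.t n :=
  (P.summable_add n).tsum_pos (fun k => (P.pos _ (by omega)).le) 0 (P.pos _ (by omega))

lemma t_succ_lt {n : ℕ} (hn : 1 ≤ n) : P.t (n + 1) < P.t n := by
  linarith [P.t_eq n, P.pos n hn]

lemma t_le_t {m n : ℕ} (hm : 1 ≤ m) (h : m ≤ n) : P.t n ≤ P.t m := by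
  induction n, h using Nat.le_induction with
  | base => exact le_rfl
  | succ k hk ih => exact (P.t_succ_lt (hm.trans hk)).le.trans ih

lemma t_le_one {n : ℕ} (hn : 1 ≤ n) : P.t n ≤ 1 := P.t_one ▸ P.t_le_t le_rfl hn

lemma t_lt_one {n : ℕ} (hn : 2 ≤ n) : P.t n < 1 :=
  (P.t_le_t (by norm_num) hn).trans_lt (P.t_one ▸ P.t_succ_lt le_rfl)

lemma a_lt_t {n : ℕ} (hn : 1 ≤ n) : P.a n < P.t n := by
  linarith [P.t_eq n, P.t_pos (n := n + 1) (by omega)]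

lemma tendsto_t : Tendsto P.t atTop (𝓝 0) := by
  have h := tendsto_sum_nat_add P.a
  simp only [add_comm _] at h
  exact h

lemma t_sub_t (m k : ℕ) : P.t m - P.t (m + k) = ∑ i ∈ Finset.range k, P.a (m + i) := by
  induction k with
  | zero => simp
  | succ k ih =>
    rw [Finset.sum_range_succ, ← ih]
    have := P.t_eq (m + k)
    rw [← add_assoc]
    linarith

lemma digit_eq {n : ℕ} {x : ℝ} (hn : 1 ≤ n) (hx : x ∈ Ioc (P.t (n + 1)) (P.t n)) :
    P.digit x = n := by
  have : {n | 1 ≤ n ∧ x ∈ Ioc (P.t (n + 1)) (P.t n)} = {n} := by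
    ext m
    simp only [mem_ofPred_eq, mem_singleton_iff]
    constructor
    · rintro ⟨hm, hxm⟩
      by_contra hne
      rcases lt_or_gt_of_ne hne with h | h
      · linarith [P.t_le_t (by omega : 1 ≤ m + 1) h, hx.2, hxm.1]
      · linarith [P.t_le_t (by omega : 1 ≤ n + 1) h, hx.1, hxm.2]
    · rintro rfl
      exact ⟨hn, hx⟩
  rw [digit, this, csInf_singleton]

lemma mem_of_digit_ne_zero {x : ℝ} (h : P.digit x ≠ 0) :
    x ∈ Ioc (P.t (P.digit x + 1)) (P.t (P.digit x)) :=
  (Nat.sInf_mem (Nat.nonempty_of_pos_sInf (Nat.pos_of_ne_zero h))).2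

lemma map_eq {n : ℕ} {x : ℝ} (hn : 1 ≤ n) (h : P.digit x = n) :
    P.map x = (P.t n - x) / P.a n := by
  simp [map, h, Nat.one_le_iff_ne_zero.1 hn]

lemma dseq_succ (n : ℕ) (x : ℝ) : P.dseq (n + 1) x = P.dseq n (P.map x) := rfl

/-- The inverse branch of the α-Lüroth map on the `n`-th atom. -/
noncomputable def branch (n : ℕ) (x : ℝ) : ℝ := P.t n - P.a n * x

lemma branch_mem {n : ℕ} (hn : 1 ≤ n) {x : ℝ} (hx : x ∈ Ico (0 : ℝ) 1) :
    P.branch n x ∈ Ioc (P.t (n + 1)) (P.t n) := by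
  have h := P.pos n hn
  have := P.t_eq n
  constructor <;> simp only [branch] <;> nlinarith [hx.1, hx.2]

lemma digit_branch {n : ℕ} (hn : 1 ≤ n) {x : ℝ} (hx : x ∈ Ico (0 : ℝ) 1) :
    P.digit (P.branch n x) = n :=
  P.digit_eq hn (P.branch_mem hn hx)

lemma map_branch {n : ℕ} (hn : 1 ≤ n) {x : ℝ} (hx : x ∈ Ico (0 : ℝ) 1) :
    P.map (P.branch n x) = x := by
  rw [P.map_eq hn (P.digit_branch hn hx), branch]
  have := (P.pos n hn).ne'
  field_simp
  ring

lemma branch_map {x : ℝ} (h : P.digit x ≠ 0) : P.branch (P.digit x) (P.map x) = x := by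
  have hn := Nat.one_le_iff_ne_zero.2 h
  rw [P.map_eq hn rfl, branch]
  have := (P.pos _ hn).ne'
  field_simp
  ring

lemma lipschitzWith_branch {n : ℕ} (hn : 1 ≤ n) :
    LipschitzWith (P.a n).toNNReal (P.branch n) :=
  LipschitzWith.of_dist_le_mul fun x y => by
    rw [Real.coe_toNNReal _ (P.pos n hn).le, Real.dist_eq, Real.dist_eq,
      show P.branch n x - P.branch n y = P.a n * (y - x) by simp only [branch]; ring,
      abs_mul, abs_of_pos (P.pos n hn), abs_sub_comm]

lemma map_mem_goodSet {N : ℕ} {x : ℝ} (hx : x ∈ P.goodSet N) : P.map x ∈ P.goodSet N := by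
  have h : ∀ n, N < P.dseq n (P.map x) := fun n => hx.2 (n + 1)
  have h0 : P.digit (P.map x) ≠ 0 := (Nat.zero_le N |>.trans_lt (h 0)).ne'
  have hm := P.mem_of_digit_ne_zero h0
  exact ⟨⟨(P.t_pos (by omega)).trans hm.1, hm.2.trans (P.t_le_one (by omega))⟩, h⟩

end LurothData

lemma ENNReal.tsum_pi_prod_eq_pow (f : ℕ → ENNReal) (k : ℕ) :
    ∑' w : Fin k → ℕ, ∏ i, f (w i) = (∑' n, f n) ^ k := by
  induction k with
  | zero => simp
  | succ k ih =>
    rw [← (Fin.consEquiv fun _ => ℕ).tsum_eq]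
    simp only [Fin.consEquiv, Equiv.coe_fn_mk, Fin.prod_univ_succ, Fin.cons_zero, Fin.cons_succ]
    rw [ENNReal.tsum_prod (f := fun a (b : Fin k → ℕ) => f a * ∏ i, f (b i))]
    simp only [ENNReal.tsum_mul_left, ENNReal.tsum_mul_right, ih, pow_succ, mul_comm]

namespace LurothData

variable (P : LurothData)

/-- The image of `[0,1]` under the composition of the branches indexed by `N + 1 + w i`. -/
noncomputable def branchImage (N : ℕ) : (k : ℕ) → (Fin k → ℕ) → Set ℝ
  | 0, _ => Icc 0 1
  | k + 1, w => P.branch (N + 1 + w 0) '' branchImage N k (Fin.tail w)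

lemma goodSet_subset_iUnion_branchImage (N k : ℕ) :
    P.goodSet N ⊆ ⋃ w, P.branchImage N k w := by
  induction k with
  | zero => exact fun x hx => mem_iUnion.2 ⟨Fin.elim0, hx.1.1.le, hx.1.2⟩
  | succ k ih =>
    intro x hx
    obtain ⟨w, hw⟩ := mem_iUnion.1 (ih (P.map_mem_goodSet hx))
    have h0 : N < P.digit x := hx.2 0
    refine mem_iUnion.2 ⟨Fin.cons (P.digit x - (N + 1)) w, P.map x, ?_, ?_⟩
    · simpa using hw
    · rw [Fin.cons_zero, Nat.add_sub_cancel' h0]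
      exact P.branch_map (by omega)

lemma ediam_branchImage_le (N k : ℕ) (w : Fin k → ℕ) :
    Metric.ediam (P.branchImage N k w) ≤ ∏ i, ENNReal.ofReal (P.a (N + 1 + w i)) := by
  induction k with
  | zero => simp [branchImage]
  | succ k ih =>
    rw [Fin.prod_univ_succ]
    exact ((P.lipschitzWith_branch (by omega)).ediam_image_le _).trans
      (mul_le_mul_right (ih _) _)

theorem dimH_goodSet_le {N : ℕ} (hN : 1 ≤ N) {s : NNReal}
    (h : ∑' n, ENNReal.ofReal (P.a (N + 1 + n)) ^ (s : ℝ) ≤ 1) : dimH (P.goodSet N) ≤ s := by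
  refine dimH_le_of_hausdorffMeasure_ne_top (ne_top_of_le_ne_top ENNReal.one_ne_top ?_)
  have hr : ENNReal.ofReal (P.t (N + 1)) < 1 := by
    simpa using P.t_lt_one (n := N + 1) (by omega)
  refine (Measure.hausdorffMeasure_le_liminf_tsum (s : ℝ) (P.goodSet N)
    (fun k : ℕ => ENNReal.ofReal (P.t (N + 1)) ^ k)
    (ENNReal.tendsto_pow_atTop_nhds_zero_of_lt_one hr)
    (fun k => P.branchImage N k) (.of_forall fun k w => ?_)
    (.of_forall fun k => P.goodSet_subset_iUnion_branchImage N k)).trans ?_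
  · refine (P.ediam_branchImage_le N k w).trans ?_
    refine (Finset.prod_le_pow_card _ _ (ENNReal.ofReal (P.t (N + 1))) fun i _ => ?_).trans (by simp)
    exact ENNReal.ofReal_le_ofReal ((P.a_lt_t (by omega)).le.trans
      (P.t_le_t (by omega) (by omega)))
  · refine liminf_le_of_le (by isBoundedDefault) fun b hb => ?_
    obtain ⟨k, hk⟩ := hb.exists
    refine hk.trans ?_
    calc ∑' w, Metric.ediam (P.branchImage N k w) ^ (s : ℝ)
        ≤ ∑' w : Fin k → ℕ, ∏ i, ENNReal.ofReal (P.a (N + 1 + w i)) ^ (s : ℝ) := by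
          refine ENNReal.tsum_le_tsum fun w => ?_
          rw [ENNReal.prod_rpow_of_nonneg (r := (s : ℝ)) s.2]
          exact ENNReal.rpow_le_rpow (P.ediam_branchImage_le N k w) s.2
      _ = (∑' n, ENNReal.ofReal (P.a (N + 1 + n)) ^ (s : ℝ)) ^ k :=
          ENNReal.tsum_pi_prod_eq_pow (fun n => ENNReal.ofReal (P.a (N + 1 + n)) ^ (s : ℝ)) k
      _ ≤ 1 := pow_le_one₀ (zero_le) h

end LurothData

namespace LurothData

variable (P : LurothData) {F : Finset ℕ}

/-- The `k`-th convergent of the point with digit sequence `ω`. -/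
noncomputable def convergent : ℕ → (ℕ → F) → ℝ
  | 0, _ => 0
  | k + 1, ω => P.branch (ω 0) (convergent k fun i => ω (i + 1))

/-- The point with digit sequence `ω`. -/
noncomputable def coding (ω : ℕ → F) : ℝ := limUnder atTop fun k => P.convergent k ω

lemma measurable_convergent (k : ℕ) : Measurable (P.convergent (F := F) k) := by
  induction k with
  | zero => exact measurable_const
  | succ k ih =>
    have h : Measurable fun ω : ℕ → F => P.convergent k fun i => ω (i + 1) :=
      ih.comp (measurable_pi_lambda _ fun i => measurable_pi_apply (i + 1))
    have hf (f : F → ℝ) : Measurable fun ω : ℕ → F => f (ω 0) :=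
      (measurable_of_countable f).comp (measurable_pi_apply 0)
    exact (hf fun n => P.t n).sub ((hf fun n => P.a n).mul h)

section

variable {P} {N : ℕ} (hN : 1 ≤ N) (hF : ∀ n ∈ F, N < n)
include hN hF

lemma branch_mem_Icc {n : ℕ} (hn : n ∈ F) {x : ℝ} (hx : x ∈ Icc 0 (P.t (N + 1))) :
    P.branch n x ∈ Icc 0 (P.t (N + 1)) := by
  have h := hF n hn
  have hm := P.branch_mem (n := n) (by omega) ⟨hx.1, hx.2.trans_lt (P.t_lt_one (by omega))⟩
  exact ⟨(P.t_pos (by omega)).le.trans hm.1.le, hm.2.trans (P.t_le_t (by omega) h)⟩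

lemma convergent_mem (k : ℕ) (ω : ℕ → F) : P.convergent k ω ∈ Icc 0 (P.t (N + 1)) := by
  induction k generalizing ω with
  | zero => exact ⟨le_rfl, (P.t_pos (by omega)).le⟩
  | succ k ih => exact branch_mem_Icc hN hF (ω 0).2 (ih _)

lemma a_le_t_of_mem (n : F) : P.a n ≤ P.t (N + 1) :=
  have h := hF n n.2
  (P.a_lt_t (by omega)).le.trans (P.t_le_t (by omega) h)

lemma dist_convergent_le (k : ℕ) (ω : ℕ → F) :
    dist (P.convergent k ω) (P.convergent (k + 1) ω) ≤ 1 * P.t (N + 1) ^ k := by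
  induction k generalizing ω with
  | zero =>
    have h := convergent_mem (P := P) hN hF 1 ω
    rw [dist_comm, Real.dist_eq, show P.convergent 0 ω = 0 from rfl, sub_zero, abs_of_nonneg h.1]
    simpa using h.2.trans (P.t_le_one (by omega))
  | succ k ih =>
    have h := hF _ (ω 0).2
    have ha := P.pos (ω 0) (by omega)
    refine ((P.lipschitzWith_branch (n := ω 0) (by omega)).dist_le_mul _ _).trans ?_
    rw [Real.coe_toNNReal _ ha.le]
    calc P.a (ω 0) * _ ≤ P.t (N + 1) * (1 * P.t (N + 1) ^ k) :=
          mul_le_mul (a_le_t_of_mem hN hF (ω 0)) (ih _) dist_nonneg (P.t_pos (by omega)).le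
      _ = _ := by ring

lemma tendsto_convergent (ω : ℕ → F) :
    Tendsto (fun k => P.convergent k ω) atTop (𝓝 (P.coding ω)) :=
  CauchySeq.tendsto_limUnder <| cauchySeq_of_le_geometric _ 1 (P.t_lt_one (by omega))
    fun k => dist_convergent_le hN hF k ω

lemma measurable_coding : Measurable (P.coding (F := F)) :=
  measurable_of_tendsto_metrizable P.measurable_convergent
    (tendsto_pi_nhds.2 (tendsto_convergent hN hF))

lemma coding_mem (ω : ℕ → F) : P.coding ω ∈ Icc 0 (P.t (N + 1)) :=
  isClosed_Icc.mem_of_tendsto (tendsto_convergent hN hF ω)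
    (.of_forall fun k => convergent_mem hN hF k ω)

lemma coding_mem_Ico (ω : ℕ → F) : P.coding ω ∈ Ico (0 : ℝ) 1 :=
  ⟨(coding_mem hN hF ω).1, (coding_mem hN hF ω).2.trans_lt (P.t_lt_one (by omega))⟩

lemma coding_eq (ω : ℕ → F) : P.coding ω = P.branch (ω 0) (P.coding fun i => ω (i + 1)) := by
  refine tendsto_nhds_unique ((tendsto_add_atTop_iff_nat 1).2 (tendsto_convergent hN hF ω)) ?_
  exact tendsto_const_nhds.sub (tendsto_const_nhds.mul (tendsto_convergent hN hF _))

lemma dseq_coding (k : ℕ) (ω : ℕ → F) : P.dseq k (P.coding ω) = ω k := by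
  have h := hF _ (ω 0).2
  induction k generalizing ω with
  | zero =>
    rw [coding_eq hN hF ω]
    exact P.digit_branch (by omega) (coding_mem_Ico hN hF _)
  | succ k ih =>
    rw [dseq_succ, coding_eq hN hF ω, P.map_branch (by omega) (coding_mem_Ico hN hF _),
      ih _ (hF _ (ω 1).2)]

lemma coding_mem_goodSet (ω : ℕ → F) : P.coding ω ∈ P.goodSet N := by
  refine ⟨⟨?_, (coding_mem_Ico hN hF ω).2.le⟩, fun k => ?_⟩
  · have h := hF _ (ω 0).2
    rw [coding_eq hN hF ω]
    exact (P.t_pos (by omega)).trans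
      (P.branch_mem (n := ω 0) (by omega) (coding_mem_Ico hN hF _)).1
  · rw [dseq_coding hN hF]
    exact hF _ (ω k).2

lemma sub_le_coding_sub_of_lt {ω η : ℕ → F} (h : (ω 0 : ℕ) < η 0) :
    P.a (ω 0) * (1 - P.t (N + 1)) ≤ P.coding ω - P.coding η := by
  have h0 := hF _ (ω 0).2
  have h1 := hF _ (η 0).2
  have hη := (P.branch_mem (n := η 0) (by omega)
    (coding_mem_Ico (P := P) hN hF fun i => η (i + 1))).2
  rw [← coding_eq hN hF] at hη
  have ht := P.t_le_t (by omega : 1 ≤ (ω 0 : ℕ) + 1) h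
  have hx := (coding_mem (P := P) hN hF fun i => ω (i + 1)).2
  have hm := mul_le_mul_of_nonneg_left hx (P.pos (ω 0) (by omega)).le
  rw [coding_eq hN hF ω, branch]
  linarith [P.t_eq (ω 0)]

lemma prod_mul_le_abs_coding_sub {c : ℝ} (hc : ∀ n ∈ F, c ≤ P.a n * (1 - P.t (N + 1))) (k : ℕ)
    {ω η : ℕ → F} (h : ∀ j < k, ω j = η j) (hk : ω k ≠ η k) :
    (∏ j ∈ Finset.range k, P.a (ω j)) * c ≤ |P.coding ω - P.coding η| := by
  induction k generalizing ω η with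
  | zero =>
    rw [Finset.prod_range_zero, one_mul]
    rcases lt_or_gt_of_ne (Subtype.coe_ne_coe.2 hk) with h | h
    · exact ((hc _ (ω 0).2).trans (sub_le_coding_sub_of_lt hN hF h)).trans (le_abs_self _)
    · rw [abs_sub_comm]
      exact ((hc _ (η 0).2).trans (sub_le_coding_sub_of_lt hN hF h)).trans (le_abs_self _)
  | succ k ih =>
    have h0 := hF _ (ω 0).2
    have ha := P.pos (ω 0) (by omega)
    have := ih (ω := fun i => ω (i + 1)) (η := fun i => η (i + 1))
      (fun j hj => h (j + 1) (by omega)) hk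
    rw [coding_eq hN hF ω, coding_eq hN hF η, ← h 0 (by omega), Finset.prod_range_succ',
      show ∀ x y, P.branch (ω 0) x - P.branch (ω 0) y = P.a (ω 0) * (y - x) by
        intros; simp only [branch]; ring, abs_mul, abs_of_pos ha, abs_sub_comm]
    nlinarith

lemma measure_preimage_coding_mul_le {s c : ℝ} (hs : 0 < s) (hc0 : 0 < c)
    (hc : ∀ n ∈ F, c ≤ P.a n * (1 - P.t (N + 1))) (ν : Measure F) [IsProbabilityMeasure ν]
    (hν : ∀ n : F, ν {n} ≤ ENNReal.ofReal (P.a n) ^ s) (A : Set ℝ) :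
    ENNReal.ofReal c ^ s * Measure.infinitePi (fun _ : ℕ => ν) (P.coding (F := F) ⁻¹' A)
      ≤ Metric.ediam A ^ s := by
  set μ := Measure.infinitePi fun _ : ℕ => ν
  have hcyl (k : ℕ) (ω : ℕ → F) : μ ((Finset.range k : Set ℕ).pi fun j => {ω j}) ≤
      ENNReal.ofReal (∏ j ∈ Finset.range k, P.a (ω j)) ^ s := by
    rw [Measure.infinitePi_pi _ fun _ _ => measurableSet_singleton _,
      ENNReal.ofReal_prod_of_nonneg fun j _ => (P.pos _ (by have := hF _ (ω j).2; omega)).le,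
      ← ENNReal.prod_rpow_of_nonneg hs.le]
    exact Finset.prod_le_prod' fun j _ => hν (ω j)
  rcases (P.coding (F := F) ⁻¹' A).eq_empty_or_nonempty with hB | ⟨ω, hω⟩
  · simp [hB]
  by_cases h : ∃ k, ∃ η ∈ P.coding (F := F) ⁻¹' A, ω k ≠ η k
  · classical
    obtain ⟨η, hη, hne⟩ := Nat.find_spec h
    set k := Nat.find h
    have hlt {j : ℕ} (hj : j < k) {ξ : ℕ → F} (hξ : ξ ∈ P.coding (F := F) ⁻¹' A) : ω j = ξ j := by
      by_contra hne
      exact Nat.find_min h hj ⟨ξ, hξ, hne⟩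
    have hsub : P.coding (F := F) ⁻¹' A ⊆ (Finset.range k : Set ℕ).pi fun j => {ω j} :=
      fun ξ hξ j hj => (hlt (by simpa using hj) hξ).symm
    calc ENNReal.ofReal c ^ s * μ (P.coding (F := F) ⁻¹' A)
        ≤ ENNReal.ofReal c ^ s * ENNReal.ofReal (∏ j ∈ Finset.range k, P.a (ω j)) ^ s :=
          mul_le_mul_right ((measure_mono hsub).trans (hcyl k ω)) _
      _ = ENNReal.ofReal ((∏ j ∈ Finset.range k, P.a (ω j)) * c) ^ s := by
          rw [← ENNReal.mul_rpow_of_nonneg _ _ hs.le, ← ENNReal.ofReal_mul hc0.le, mul_comm]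
      _ ≤ ENNReal.ofReal |P.coding ω - P.coding η| ^ s := by
          gcongr
          exact prod_mul_le_abs_coding_sub hN hF hc k (fun j hj => hlt hj hη) hne
      _ ≤ Metric.ediam A ^ s := by
          rw [← Real.dist_eq, ← edist_dist]
          gcongr
          exact Metric.edist_le_ediam_of_mem hω hη
  · push Not at h
    have hr : ENNReal.ofReal (P.t (N + 1)) < 1 := by
      simpa using P.t_lt_one (n := N + 1) (by omega)
    have hle (k : ℕ) : μ (P.coding (F := F) ⁻¹' A) ≤ (ENNReal.ofReal (P.t (N + 1)) ^ k) ^ s := by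
      have hsub : P.coding (F := F) ⁻¹' A ⊆ (Finset.range k : Set ℕ).pi fun j => {ω j} :=
        fun ξ hξ j _ => (h j ξ hξ).symm
      refine ((measure_mono hsub).trans (hcyl k ω)).trans ?_
      gcongr
      rw [ENNReal.ofReal_prod_of_nonneg fun j _ => (P.pos _ (by have := hF _ (ω j).2; omega)).le]
      refine (Finset.prod_le_pow_card _ _ (ENNReal.ofReal (P.t (N + 1))) fun j _ => ?_).trans
        (by simp)
      exact ENNReal.ofReal_le_ofReal (a_le_t_of_mem hN hF (ω j))
    have hlim : Tendsto (fun k : ℕ => (ENNReal.ofReal (P.t (N + 1)) ^ k) ^ s) atTop (𝓝 0) := by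
      have := (ENNReal.continuous_rpow_const (y := s)).tendsto 0
      rw [ENNReal.zero_rpow_of_pos hs] at this
      exact this.comp (ENNReal.tendsto_pow_atTop_nhds_zero_of_lt_one hr)
    rw [le_antisymm (ge_of_tendsto' hlim hle) (zero_le), mul_zero]
    exact zero_le

theorem le_dimH_goodSet {s : NNReal} (hs : 0 < s)
    (h : 1 ≤ ∑ n ∈ F, ENNReal.ofReal (P.a n) ^ (s : ℝ)) : s ≤ dimH (P.goodSet N) := by
  set S := ∑ n ∈ F, ENNReal.ofReal (P.a n) ^ (s : ℝ)
  have hS0 : S ≠ 0 := (zero_lt_one.trans_le h).ne'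
  have hS1 : S ≠ ⊤ := ENNReal.sum_ne_top.2 fun n _ =>
    ENNReal.rpow_ne_top_of_nonneg s.2 ENNReal.ofReal_ne_top
  have hne : F.Nonempty := by
    rw [Finset.nonempty_iff_ne_empty]
    rintro rfl
    simp [S] at hS0
  obtain ⟨m, hm, hmin⟩ := F.exists_min_image P.a hne
  have hr : 0 < 1 - P.t (N + 1) := sub_pos.2 (P.t_lt_one (by omega))
  set c := P.a m * (1 - P.t (N + 1))
  have hc0 : 0 < c := mul_pos (P.pos m (by have := hF m hm; omega)) hr
  have hc : ∀ n ∈ F, c ≤ P.a n * (1 - P.t (N + 1)) := fun n hn =>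
    mul_le_mul_of_nonneg_right (hmin n hn) hr.le
  let p : PMF F := PMF.ofFintype (fun n => ENNReal.ofReal (P.a n) ^ (s : ℝ) / S) (by
    simp only [div_eq_mul_inv]
    rw [← Finset.sum_mul, Finset.sum_coe_sort F fun n => ENNReal.ofReal (P.a n) ^ (s : ℝ)]
    exact ENNReal.mul_inv_cancel hS0 hS1)
  have hν (n : F) : p.toMeasure {n} ≤ ENNReal.ofReal (P.a n) ^ (s : ℝ) := by
    rw [p.toMeasure_apply_singleton _ (measurableSet_singleton _), PMF.ofFintype_apply]
    exact ENNReal.div_le_of_le_mul (le_mul_of_one_le_right (zero_le) h)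
  set μ := Measure.infinitePi fun _ : ℕ => p.toMeasure
  have hX := measurable_coding (P := P) hN hF
  have hle : ENNReal.ofReal c ^ (s : ℝ) • μ.map P.coding ≤ μH[s] := by
    refine Measure.le_hausdorffMeasure _ _ 1 one_pos fun A _ => ?_
    refine (measure_mono subset_closure).trans ?_
    rw [Measure.smul_apply, smul_eq_mul, Measure.map_apply hX isClosed_closure.measurableSet,
      ← Metric.ediam_closure A]
    exact measure_preimage_coding_mul_le hN hF (NNReal.coe_pos.2 hs) hc0 hc p.toMeasure hν _
  refine le_dimH_of_hausdorffMeasure_ne_zero (ne_of_gt ?_)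
  refine lt_of_lt_of_le ?_ (hle (P.goodSet N))
  have hone : 1 ≤ μ.map P.coding (P.goodSet N) := by
    refine le_trans ?_ (Measure.le_map_apply hX.aemeasurable _)
    rw [preimage_eq_univ_iff.2 (range_subset_iff.2 (coding_mem_goodSet hN hF)), measure_univ]
  rw [Measure.smul_apply, smul_eq_mul]
  exact ENNReal.mul_pos (ENNReal.rpow_pos (by simpa using hc0) ENNReal.ofReal_ne_top).ne'
    (zero_lt_one.trans_le hone).ne'

end

end LurothData

namespace LurothData

variable {P : LurothData} {θ : ℝ}

lemma Expansive.tendsto_t_ratio (hexp : P.Expansive θ) :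
    Tendsto (fun k : ℕ => P.t (2 ^ (k + 1)) / P.t (2 ^ k)) atTop (𝓝 (2 ^ (-θ))) := by
  obtain ⟨ψ, hψ, hslow, ht⟩ := hexp
  have h := ((hslow 2 two_pos).comp (tendsto_pow_atTop_atTop_of_one_lt one_lt_two)).mul_const
    ((2 : ℝ) ^ (-θ))
  rw [one_mul] at h
  refine h.congr fun k => ?_
  have h2 : (0 : ℝ) < ((2 ^ k : ℕ) : ℝ) := by positivity
  rw [ht _ Nat.one_le_two_pow, ht _ Nat.one_le_two_pow, pow_succ', Nat.cast_mul,
    Real.mul_rpow (by positivity) h2.le]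
  have := (hψ (2 ^ k)).ne'
  have := (Real.rpow_pos_of_pos h2 (-θ)).ne'
  simp only [Function.comp_apply, Nat.cast_ofNat]
  field_simp

lemma EventuallyDecreasing.le_of_le (hdec : P.EventuallyDecreasing) :
    ∃ K, ∀ m n, K ≤ m → m ≤ n → P.a n ≤ P.a m := by
  obtain ⟨K, hK⟩ := hdec
  refine ⟨K, fun m n hm hn => ?_⟩
  induction n, hn using Nat.le_induction with
  | base => exact le_rfl
  | succ n hn ih => exact (hK n (hm.trans hn)).le.trans ih

lemma EventuallyDecreasing.mul_a_le_t (hdec : P.EventuallyDecreasing) :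
    ∀ᶠ m in atTop, m * P.a (2 * m) ≤ P.t m := by
  obtain ⟨K, hK⟩ := hdec.le_of_le
  filter_upwards [eventually_ge_atTop K, eventually_ge_atTop 1] with m hm hm1
  have h : ∑ _i ∈ Finset.range m, P.a (2 * m) ≤ ∑ i ∈ Finset.range m, P.a (m + i) :=
    Finset.sum_le_sum fun i hi => by
      rw [Finset.mem_range] at hi
      exact hK _ _ (by omega) (by omega)
  rw [← P.t_sub_t, Finset.sum_const, Finset.card_range, nsmul_eq_mul] at h
  linarith [P.t_pos (n := m + m) (by omega)]

lemma EventuallyDecreasing.t_sub_t_le (hdec : P.EventuallyDecreasing) :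
    ∀ᶠ m in atTop, P.t m - P.t (2 * m) ≤ m * P.a m := by
  obtain ⟨K, hK⟩ := hdec.le_of_le
  filter_upwards [eventually_ge_atTop K] with m hm
  rw [two_mul, P.t_sub_t, ← nsmul_eq_mul, ← Finset.card_range m, ← Finset.sum_const,
    Finset.card_range]
  exact Finset.sum_le_sum fun i _ => hK _ _ hm (by omega)

lemma EventuallyDecreasing.summable_condensed_iff (hdec : P.EventuallyDecreasing) {s : ℝ}
    (hs : 0 ≤ s) :
    (Summable fun k : ℕ => (2 : ℝ) ^ k * P.a (2 ^ k) ^ s) ↔ Summable fun n => P.a n ^ s := by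
  refine summable_condensed_iff_of_eventually_nonneg (f := fun n => P.a n ^ s) ?_ ?_
  · filter_upwards [eventually_ge_atTop 1] with n hn
    exact Real.rpow_nonneg (P.pos n hn).le s
  · obtain ⟨K, hK⟩ := hdec.le_of_le
    filter_upwards [eventually_ge_atTop K] with n hn
    exact Real.rpow_le_rpow (P.pos _ (by omega)).le (hK _ _ hn (by omega)) hs

lemma tendsto_two_pow : Tendsto (fun k : ℕ => 2 ^ k) atTop atTop :=
  tendsto_pow_atTop_atTop_of_one_lt one_lt_two

theorem summable_a_rpow (hexp : P.Expansive θ) (hdec : P.EventuallyDecreasing) {s : ℝ}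
    (hs : 0 ≤ s) (h : 1 < s * (1 + θ)) : Summable fun n => P.a n ^ s := by
  rw [← hdec.summable_condensed_iff hs, ← summable_nat_add_iff 1]
  have ht (k : ℕ) : 0 < P.t (2 ^ k) := P.t_pos Nat.one_le_two_pow
  have hb : Summable fun k : ℕ => (2 : ℝ) ^ (k + 1) * (P.t (2 ^ k) / 2 ^ k) ^ s := by
    have hpos (k : ℕ) : 0 < (2 : ℝ) ^ (k + 1) * (P.t (2 ^ k) / 2 ^ k) ^ s := by
      have := ht k
      positivity
    have hlim : Tendsto (fun k : ℕ => 2 * (P.t (2 ^ (k + 1)) / P.t (2 ^ k) / 2) ^ s) atTop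
        (𝓝 (2 * ((2 : ℝ) ^ (-θ) / 2) ^ s)) :=
      ((hexp.tendsto_t_ratio.div_const 2).rpow_const (.inr hs)).const_mul 2
    refine summable_of_ratio_test_tendsto_lt_one ?_ (.of_forall fun k => (hpos k).ne')
      (hlim.congr fun k => ?_)
    · have : (2 : ℝ) * ((2 : ℝ) ^ (-θ) / 2) ^ s = 2 ^ (1 - s * (1 + θ)) := by
        rw [← Real.rpow_sub_one two_ne_zero, ← Real.rpow_mul zero_le_two,
          ← Real.rpow_one_add' zero_le_two]
        · congr 1; ring
        · nlinarith
      rw [this]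
      exact Real.rpow_lt_one_of_one_lt_of_neg one_lt_two (by linarith)
    · rw [Real.norm_of_nonneg (hpos _).le, Real.norm_of_nonneg (hpos _).le]
      have h1 := ht k
      have h2 := ht (k + 1)
      rw [mul_div_mul_comm, ← Real.div_rpow (by positivity) (by positivity)]
      congr 1
      · field_simp
        ring
      · congr 1
        field_simp
        ring
  refine Summable.of_norm_bounded_eventually_nat hb ?_
  filter_upwards [tendsto_two_pow.eventually hdec.mul_a_le_t] with k hk
  have ha := P.pos (2 ^ (k + 1)) Nat.one_le_two_pow
  rw [Real.norm_of_nonneg (by positivity)]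
  gcongr
  rw [le_div_iff₀ (by positivity), mul_comm, pow_succ']
  exact_mod_cast hk

lemma t_two_pow_le {q : ℝ} (hq0 : 0 ≤ q) (hq1 : q < 1)
    (h : ∀ᶠ k : ℕ in atTop, P.t (2 ^ k) - P.t (2 ^ (k + 1)) ≤ q ^ k) :
    ∀ᶠ k : ℕ in atTop, P.t (2 ^ k) ≤ q ^ k / (1 - q) := by
  obtain ⟨K, hK⟩ := eventually_atTop.1 h
  have hq : 1 - q ≠ 0 := by linarith
  have hmono : Monotone fun k : ℕ => P.t (2 ^ (k + K)) - q ^ (k + K) / (1 - q) := by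
    refine monotone_nat_of_le_succ fun k => ?_
    have h1 := hK (k + K) (by omega)
    have h2 : q ^ (k + K) / (1 - q) - q ^ (k + 1 + K) / (1 - q) = q ^ (k + K) := by
      field_simp
      ring
    rw [show k + 1 + K = k + K + 1 by ring] at h2 ⊢
    linarith
  have hlim : Tendsto (fun k : ℕ => P.t (2 ^ (k + K)) - q ^ (k + K) / (1 - q)) atTop
      (𝓝 (0 - 0 / (1 - q))) :=
    (tendsto_add_atTop_iff_nat K).2 <| (P.tendsto_t.comp tendsto_two_pow).sub
      ((tendsto_pow_atTop_nhds_zero_of_lt_one hq0 hq1).div_const _)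
  rw [zero_div, sub_zero] at hlim
  filter_upwards [eventually_ge_atTop K] with k hk
  have := hmono.ge_of_tendsto hlim (k - K)
  simp only [Nat.sub_add_cancel hk] at this
  linarith

theorem not_summable_a_rpow (hθ : 0 ≤ θ) (hexp : P.Expansive θ) (hdec : P.EventuallyDecreasing)
    {s : ℝ} (hs : 0 < s) (h : s * (1 + θ) < 1) : ¬ Summable fun n => P.a n ^ s := by
  intro hsum
  rw [← hdec.summable_condensed_iff hs.le] at hsum
  set q : ℝ := 2 * (1 / 2) ^ (1 / s) with hq
  have hq0 : 0 < q := by positivity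
  have hqθ : q < 2 ^ (-θ) := by
    have : q = 2 ^ (1 - 1 / s) := by
      rw [hq, one_div (2 : ℝ), Real.inv_rpow zero_le_two, Real.rpow_sub two_pos, Real.rpow_one,
        ← div_eq_mul_inv]
    rw [this]
    refine Real.rpow_lt_rpow_of_exponent_lt one_lt_two ?_
    have : 1 + θ < 1 / s := by
      rw [lt_div_iff₀ hs]
      linarith
    linarith
  obtain ⟨ρ, hqρ, hρθ⟩ := exists_between hqθ
  have hρ0 : 0 < ρ := hq0.trans hqρ
  have hq1 : q < 1 :=
    hqθ.trans_le (Real.rpow_le_one_of_one_le_of_nonpos one_le_two (by linarith))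
  have hdiff : ∀ᶠ k : ℕ in atTop, P.t (2 ^ k) - P.t (2 ^ (k + 1)) ≤ q ^ k := by
    filter_upwards [hsum.tendsto_atTop_zero.eventually (gt_mem_nhds one_pos),
      tendsto_two_pow.eventually hdec.t_sub_t_le] with k hk hd
    have ha := P.pos (2 ^ k) Nat.one_le_two_pow
    have hle : P.a (2 ^ k) ≤ ((1 / 2) ^ (1 / s)) ^ k := by
      rw [← Real.rpow_le_rpow_iff ha.le (by positivity) hs, ← Real.rpow_natCast,
        ← Real.rpow_mul (by positivity), ← Real.rpow_mul (by positivity),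
        show 1 / s * (k * s) = (k : ℝ) by field_simp, Real.rpow_natCast, one_div, inv_pow,
        ← one_div, le_div_iff₀ (by positivity), mul_comm]
      exact hk.le
    rw [hq, mul_pow, pow_succ']
    refine hd.trans ?_
    push_cast
    gcongr
  refine not_summable_of_ratio_test_tendsto_gt_one (f := fun k : ℕ => P.t (2 ^ k) / ρ ^ k)
    ((one_lt_div hρ0).2 hρθ) ((hexp.tendsto_t_ratio.div_const ρ).congr fun k => ?_) ?_
  · have h1 := P.t_pos (n := 2 ^ k) Nat.one_le_two_pow
    have h2 := P.t_pos (n := 2 ^ (k + 1)) Nat.one_le_two_pow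
    rw [Real.norm_of_nonneg (by positivity), Real.norm_of_nonneg (by positivity), pow_succ ρ]
    field_simp
  · have hg : Summable fun k : ℕ => (q / ρ) ^ k / (1 - q) :=
      (summable_geometric_of_lt_one (by positivity) ((div_lt_one hρ0).2 hqρ)).div_const _
    refine Summable.of_norm_bounded_eventually_nat hg ?_
    filter_upwards [t_two_pow_le hq0.le hq1 hdiff] with k hk
    have h1 := P.t_pos (n := 2 ^ k) Nat.one_le_two_pow
    rw [Real.norm_of_nonneg (by positivity), div_pow, div_right_comm]
    gcongr

end LurothData

theorem good_sets_dimension (P : LurothData) (θ : ℝ) (hθ : 0 ≤ θ)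
    (hexp : P.Expansive θ) (hdec : P.EventuallyDecreasing) :
    Tendsto (fun N : ℕ => dimH (P.goodSet N)) atTop
      (𝓝 (ENNReal.ofReal (1 / (1 + θ)))) := by
  have hθ' : 0 < 1 + θ := by linarith
  refine tendsto_order.2 ⟨fun b hb => ?_, fun b hb => ?_⟩
  · obtain ⟨s, hbs, hs⟩ := ENNReal.lt_iff_exists_nnreal_btwn.1 hb
    have hs0 : 0 < s := ENNReal.coe_pos.1 (bot_le.trans_lt hbs)
    rw [ENNReal.lt_ofReal_iff_toReal_lt ENNReal.coe_ne_top, ENNReal.coe_toReal,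
      lt_div_iff₀ hθ'] at hs
    have hsum := LurothData.not_summable_a_rpow hθ hexp hdec (NNReal.coe_pos.2 hs0) hs
    filter_upwards [eventually_ge_atTop 1] with N hN
    refine hbs.trans_le ?_
    have hpos (i : ℕ) : 0 ≤ P.a (N + 1 + i) ^ (s : ℝ) :=
      Real.rpow_nonneg (P.pos _ (by omega)).le _
    have hlim : Tendsto (fun m => ∑ i ∈ Finset.range m, P.a (N + 1 + i) ^ (s : ℝ)) atTop atTop := by
      rw [← not_summable_iff_tendsto_nat_atTop_of_nonneg hpos]
      simp only [add_comm (N + 1)]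
      rwa [summable_nat_add_iff (f := fun n => P.a n ^ (s : ℝ)) (N + 1)]
    obtain ⟨m, hm⟩ := (hlim.eventually_ge_atTop 1).exists
    refine LurothData.le_dimH_goodSet (F := Finset.Ico (N + 1) (N + 1 + m)) hN
      (fun n hn => (Finset.mem_Ico.1 hn).1) hs0 ?_
    rw [Finset.sum_Ico_eq_sum_range, Nat.add_sub_cancel_left]
    simp only [fun i => ENNReal.ofReal_rpow_of_pos (p := (s : ℝ))
      (P.pos (N + 1 + i) (by omega))]
    rw [← ENNReal.ofReal_sum_of_nonneg fun i _ => hpos i]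
    exact ENNReal.one_le_ofReal.2 hm
  · obtain ⟨s, hs, hbs⟩ := ENNReal.lt_iff_exists_nnreal_btwn.1 hb
    rw [ENNReal.ofReal_lt_iff_lt_toReal (by positivity) ENNReal.coe_ne_top, ENNReal.coe_toReal,
      div_lt_iff₀ hθ'] at hs
    have hsum := LurothData.summable_a_rpow hexp hdec s.2 hs
    have hlim := (tendsto_sum_nat_add fun n => P.a n ^ (s : ℝ)).comp (tendsto_add_atTop_nat 1)
    filter_upwards [eventually_ge_atTop 1, hlim.eventually_le_const one_pos] with N hN hle
    refine (P.dimH_goodSet_le hN ?_).trans_lt hbs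
    have hpos (i : ℕ) : 0 ≤ P.a (N + 1 + i) ^ (s : ℝ) :=
      Real.rpow_nonneg (P.pos _ (by omega)).le _
    simp only [fun i => ENNReal.ofReal_rpow_of_pos (p := (s : ℝ))
      (P.pos (N + 1 + i) (by omega))]
    simp only [Function.comp_apply, add_comm _ (N + 1)] at hle
    rw [← ENNReal.ofReal_tsum_of_nonneg hpos]
    · exact ENNReal.ofReal_le_one.2 hle
    · simp only [add_comm (N + 1)]
      exact (summable_nat_add_iff (f := fun n => P.a n ^ (s : ℝ)) (N + 1)).2 hsum
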